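/- Fix an irrational α with 0 < α < 1, and let f be a measurable Roman dominating function for the irrational cycle graph G_α of measured value exactly 2/3. Then the union of all connected components of G_α containing a social vertex is a μ-null set; concretely, the set {v ∈ ℝ/ℤ : ∃ k ∈ ℤ such that v + k·α is social under f} has μ-measure zero. -/

import Mathlib

open MeasureTheory
open scoped ENNReal

/-- If a measurable Roman dominating function for the irrational cycle graph
`G_α` has measured value exactly `2/3`, then the union of all connected
components of `G_α` containing a social vertex is a null set. -/
theorem social_components_null
    (α : ℝ) (hirr : Irrational α) (h0 : 0 < α) (h1 : α < 1)
    (f : AddCircle (1:ℝ) → ℕ) (hf2 : ∀ v, f v ≤ 2)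
    (hrdf : ∀ v, f v = 0 →
      f (v + (α : AddCircle (1:ℝ))) = 2 ∨ f (v - (α : AddCircle (1:ℝ))) = 2)
    (h1m : MeasurableSet (f ⁻¹' {1})) (h2m : MeasurableSet (f ⁻¹' {2}))
    (hval : 2 * volume (f ⁻¹' {2}) + volume (f ⁻¹' {1}) = 2/3) :
    volume {v : AddCircle (1:ℝ) | ∃ k : ℤ,
      f (v + (((k : ℝ) * α : ℝ) : AddCircle (1:ℝ))) = 2 ∧
      (f (v + (((k : ℝ) * α : ℝ) : AddCircle (1:ℝ)) + (α : AddCircle (1:ℝ))) = 2 ∨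
       f (v + (((k : ℝ) * α : ℝ) : AddCircle (1:ℝ)) - (α : AddCircle (1:ℝ))) = 2)} = 0 := by
  classical
  set a : AddCircle (1:ℝ) := (α : AddCircle (1:ℝ)) with ha
  set A : Set (AddCircle (1:ℝ)) := f ⁻¹' {2} with hA
  set D : Set (AddCircle (1:ℝ)) := f ⁻¹' {1} with hD
  have tr : ∀ (S : Set (AddCircle (1:ℝ))) (c : AddCircle (1:ℝ)),
      volume ((fun x => x + c) ⁻¹' S) = volume S :=
    fun S c => measure_preimage_add_right volume c S
  set P : Set (AddCircle (1:ℝ)) := (fun x => x + a) ⁻¹' A with hP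
  set Q : Set (AddCircle (1:ℝ)) := (fun x => x + -a) ⁻¹' A with hQ
  have hPv : volume P = volume A := tr A a
  have hQv : volume Q = volume A := tr A (-a)
  have hPm : MeasurableSet P := (measurable_add_const a) h2m
  have hcov : (Set.univ : Set (AddCircle (1:ℝ))) ⊆ ((A ∪ P) ∪ Q) ∪ D := by
    intro v _
    have h2 := hf2 v
    have hr := hrdf v
    simp only [hA, hP, hQ, hD, Set.mem_union, Set.mem_preimage, Set.mem_singleton_iff,
      ← sub_eq_add_neg]
    interval_cases hfv : f v
    · rcases hr rfl with h | h
      · exact Or.inl (Or.inl (Or.inr h))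
      · exact Or.inl (Or.inr h)
    · exact Or.inr rfl
    · exact Or.inl (Or.inl (Or.inl rfl))
  have huniv : volume (Set.univ : Set (AddCircle (1:ℝ))) = 1 := by
    simp [AddCircle.measure_univ]
  have hle : (1 : ℝ≥0∞) ≤ volume (A ∪ P) + volume A + volume D := by
    rw [← huniv]
    calc _ ≤ _ := measure_mono hcov
      _ ≤ volume ((A ∪ P) ∪ Q) + volume D := measure_union_le _ _
      _ ≤ volume (A ∪ P) + volume Q + volume D := by gcongr; exact measure_union_le _ _
      _ = _ := by rw [hQv]
  have hui := measure_union_add_inter (μ := volume) A hPm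
  rw [hPv] at hui
  have hB : volume (A ∩ P) = 0 := by
    have e1 := measure_ne_top volume A
    have e2 := measure_ne_top volume D
    have e3 := measure_ne_top volume (A ∪ P)
    have e4 := measure_ne_top volume (A ∩ P)
    generalize volume A = x at *
    generalize volume D = y at *
    generalize volume (A ∪ P) = z at *
    generalize volume (A ∩ P) = w at *
    lift x to NNReal using e1
    lift y to NNReal using e2
    lift z to NNReal using e3
    lift w to NNReal using e4
    have hval' : (2 * x + y : ℝ) = 2 / 3 := by
      have := congrArg ENNReal.toReal hval
      simpa [ENNReal.toReal_add, ENNReal.mul_eq_top] using this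
    have hui' : (z + w : ℝ) = x + x := by exact_mod_cast hui
    have hle' : (1 : ℝ) ≤ z + x + y := by exact_mod_cast hle
    have hw : (w : ℝ) = 0 := by
      have := w.coe_nonneg
      have := y.coe_nonneg
      linarith
    exact_mod_cast hw
  have hnull : volume (⋃ k : ℤ, ((fun x => x + (((k : ℝ) * α : ℝ) : AddCircle (1:ℝ))) ⁻¹' (A ∩ P)
      ∪ (fun x => x + ((((k : ℝ) * α : ℝ) : AddCircle (1:ℝ)) - a)) ⁻¹' (A ∩ P))) = 0 := by
    rw [measure_iUnion_null_iff]
    intro k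
    rw [measure_union_null_iff, tr, tr]
    exact ⟨hB, hB⟩
  refine measure_mono_null ?_ hnull
  rintro v ⟨k, hk, h | h⟩
  · exact Set.mem_iUnion.2 ⟨k, Or.inl ⟨hk, h⟩⟩
  · refine Set.mem_iUnion.2 ⟨k, Or.inr ⟨?_, ?_⟩⟩
    · simpa [hA, add_sub_assoc] using h
    · simpa [hA, hP, add_assoc] using hk
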